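/- arXiv:1805.05488 — 4 statements merged into one kernel-verified Lean document; each statement's English description precedes it below -/
import Mathlib

section
/- If (A, B) is a complex Golay pair of length n, then the positionally scaled pair (i \star A, i \star B), where c \star [x_0, x_1, ..., x_{n-1}] := [x_0, c*x_1, c^2*x_2, ..., c^{n-1}*x_{n-1}], is also a complex Golay pair of length n. -/
open Complex Finset

/-- The nonperiodic autocorrelation function of a sequence of length `n`. -/
noncomputable def autocorr (n : ℕ) (A : ℕ → ℂ) (s : ℕ) : ℂ :=
  ∑ k ∈ Finset.range (n - s), A k * star (A (k + s))

/-- The entries of the first `n` terms of the sequence lie in `{1, -1, i, -i}`. -/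
def IsQuaternarySeq (n : ℕ) (A : ℕ → ℂ) : Prop :=
  ∀ k < n, A k ∈ ({1, -1, Complex.I, -Complex.I} : Set ℂ)

/-- `(A, B)` is a complex Golay pair of length `n`. -/
def IsComplexGolayPair (n : ℕ) (A B : ℕ → ℂ) : Prop :=
  IsQuaternarySeq n A ∧ IsQuaternarySeq n B ∧
    ∀ s, 1 ≤ s → s ≤ n - 1 → autocorr n A s + autocorr n B s = 0

/-- Positional scaling: multiply the `k`-th entry of the sequence by `c^k`. -/
noncomputable def posScale (c : ℂ) (X : ℕ → ℂ) : ℕ → ℂ := fun k => c ^ k * X k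

/-- Positional scaling by a unit complex number multiplies the autocorrelation by a power. -/
theorem autocorr_posScale (n : ℕ) {c : ℂ} (hc : c * star c = 1) (A : ℕ → ℂ) (s : ℕ) :
    autocorr n (posScale c A) s = star c ^ s * autocorr n A s := by
  unfold autocorr posScale
  rw [Finset.mul_sum]
  refine Finset.sum_congr rfl fun k _ => ?_
  have hk : c ^ k * star c ^ k = 1 := by rw [← mul_pow, hc, one_pow]
  rw [star_mul', star_pow, pow_add]
  linear_combination star c ^ s * A k * star (A (k + s)) * hk

/-- The set of quaternary sequences is closed under positional scaling by `i`. -/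
theorem IsQuaternarySeq.posScale_I {n : ℕ} {A : ℕ → ℂ} (h : IsQuaternarySeq n A) :
    IsQuaternarySeq n (posScale Complex.I A) := by
  have step : ∀ z ∈ ({1, -1, Complex.I, -Complex.I} : Set ℂ),
      Complex.I * z ∈ ({1, -1, Complex.I, -Complex.I} : Set ℂ) := by
    rintro z (rfl | rfl | rfl | rfl) <;> simp
  have pow_mem : ∀ (k : ℕ), ∀ z ∈ ({1, -1, Complex.I, -Complex.I} : Set ℂ),
      Complex.I ^ k * z ∈ ({1, -1, Complex.I, -Complex.I} : Set ℂ) := by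
    intro k z hz
    induction k with
    | zero => rwa [pow_zero, one_mul]
    | succ k ih =>
      rw [pow_succ', mul_assoc]
      exact step _ ih
  exact fun k hk => pow_mem k _ (h k hk)

/-- Positionally scaling both sequences of a complex Golay pair by
the imaginary unit yields a complex Golay pair. -/
theorem golay_positional_scale (n : ℕ) (A B : ℕ → ℂ) (h : IsComplexGolayPair n A B) :
    IsComplexGolayPair n (posScale Complex.I A) (posScale Complex.I B) := by
  obtain ⟨hA, hB, hAB⟩ := h
  have hI : Complex.I * star Complex.I = 1 := by simp
  refine ⟨hA.posScale_I, hB.posScale_I, fun s hs hsn => ?_⟩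
  rw [autocorr_posScale n hI, autocorr_posScale n hI, ← mul_add, hAB s hs hsn, mul_zero]
end

section
/- Let (A, B) be a complex Golay pair of length n. Then resum(A)^2 + imsum(A)^2 + resum(B)^2 + imsum(B)^2 = 2n, where resum(X) and imsum(X) denote the real and imaginary parts of the sum of all entries of the sequence X. -/
open Complex Finset

/-- The real part of the sum of the first `n` entries of `X`. -/
noncomputable def resum (n : ℕ) (X : ℕ → ℂ) : ℝ := (∑ k ∈ Finset.range n, X k).re

/-- The imaginary part of the sum of the first `n` entries of `X`. -/
noncomputable def imsum (n : ℕ) (X : ℕ → ℂ) : ℝ := (∑ k ∈ Finset.range n, X k).im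

theorem autocorr_of_le {n s : ℕ} (X : ℕ → ℂ) (h : n ≤ s) : autocorr n X s = 0 := by
  simp [autocorr, Nat.sub_eq_zero_of_le h]

theorem autocorr_succ {n j : ℕ} (X : ℕ → ℂ) (h : j < n) :
    autocorr (n + 1) X (j + 1) = autocorr n X (j + 1) + X (n - 1 - j) * star (X n) := by
  have h₁ : n + 1 - (j + 1) = n - (j + 1) + 1 := by omega
  have h₂ : n - (j + 1) = n - 1 - j := by omega
  have h₃ : n - 1 - j + (j + 1) = n := by omega
  rw [autocorr, autocorr, h₁, Finset.sum_range_succ, h₂, h₃]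

theorem sum_autocorr_succ (n : ℕ) (X : ℕ → ℂ) :
    ∑ j ∈ Finset.range (n + 1), autocorr (n + 1) X (j + 1) =
      ∑ j ∈ Finset.range n, autocorr n X (j + 1) +
        (∑ k ∈ Finset.range n, X k) * star (X n) := by
  rw [Finset.sum_range_succ, autocorr_of_le X le_rfl, add_zero,
    Finset.sum_congr rfl fun j hj => autocorr_succ X (Finset.mem_range.mp hj),
    Finset.sum_add_distrib, ← Finset.sum_mul, Finset.sum_range_reflect]

/-- The squared modulus of a sum, expanded in terms of the autocorrelations. -/
theorem normSq_sum_eq_autocorr (n : ℕ) (X : ℕ → ℂ) :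
    normSq (∑ k ∈ Finset.range n, X k) =
      ∑ k ∈ Finset.range n, normSq (X k) +
        2 * (∑ j ∈ Finset.range n, autocorr n X (j + 1)).re := by
  induction n with
  | zero => simp
  | succ n ih =>
    rw [sum_autocorr_succ, Finset.sum_range_succ, normSq_add, ih, Finset.sum_range_succ, add_re,
      starRingEnd_apply]
    ring

theorem IsQuaternarySeq.sum_normSq {n : ℕ} {X : ℕ → ℂ} (h : IsQuaternarySeq n X) :
    ∑ k ∈ Finset.range n, normSq (X k) = n := by
  have h_one : ∀ k ∈ Finset.range n, normSq (X k) = 1 := fun k hk => by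
    have hX := h k (Finset.mem_range.mp hk)
    simp only [Set.mem_insert_iff, Set.mem_singleton_iff] at hX
    rcases hX with hX | hX | hX | hX <;> simp [hX]
  simp [Finset.sum_congr rfl h_one]

theorem resum_sq_add_imsum_sq (n : ℕ) (X : ℕ → ℂ) :
    resum n X ^ 2 + imsum n X ^ 2 = normSq (∑ k ∈ Finset.range n, X k) := by
  rw [resum, imsum, normSq_apply]
  ring

/-- If `(A, B)` is a complex Golay pair of length `n`, then
`resum(A)² + imsum(A)² + resum(B)² + imsum(B)² = 2n`. -/
theorem golay_sum_of_squares (n : ℕ) (A B : ℕ → ℂ) (h : IsComplexGolayPair n A B) :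
    resum n A ^ 2 + imsum n A ^ 2 + resum n B ^ 2 + imsum n B ^ 2 = 2 * n := by
  obtain ⟨hA, hB, hAB⟩ := h
  have h_sum : ∑ j ∈ Finset.range n, autocorr n A (j + 1) +
      ∑ j ∈ Finset.range n, autocorr n B (j + 1) = 0 := by
    rw [← Finset.sum_add_distrib]
    refine Finset.sum_eq_zero fun j _ => ?_
    by_cases hj : j + 1 ≤ n - 1
    · exact hAB _ (by omega) hj
    · rw [autocorr_of_le A (by omega), autocorr_of_le B (by omega), add_zero]
  have h_re := congrArg re h_sum
  rw [add_re, zero_re] at h_re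
  have h_normSq_A := normSq_sum_eq_autocorr n A
  have h_normSq_B := normSq_sum_eq_autocorr n B
  rw [hA.sum_normSq, ← resum_sq_add_imsum_sq] at h_normSq_A
  rw [hB.sum_normSq, ← resum_sq_add_imsum_sq] at h_normSq_B
  linarith
end

section
/- Every complex Golay pair (A', B') of length n is equivalent (under the equivalence generated by reversal of both sequences, conjugate-reversal of the first sequence, swapping the two sequences, multiplying all entries of the first sequence by i, and positional scaling of both sequences by i) to a complex Golay pair (A, B) with a_0 = a_1 = b_0 = 1 and a_2 \in {1, -1, i}. -/
open Complex Finset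

/-- One application of one of the five equivalence operations E1–E5 on a pair
of length-`n` sequences. -/
def GolayStep (n : ℕ) (P Q : (ℕ → ℂ) × (ℕ → ℂ)) : Prop :=
  -- E1: reverse both sequences
  Q = ((fun k => P.1 (n - 1 - k)), (fun k => P.2 (n - 1 - k))) ∨
  -- E2: conjugate-reverse the first sequence
  Q = ((fun k => star (P.1 (n - 1 - k))), P.2) ∨
  -- E3: swap the two sequences
  Q = (P.2, P.1) ∨
  -- E4: multiply every entry of the first sequence by i
  Q = ((fun k => Complex.I * P.1 k), P.2) ∨
  -- E5: positionally scale both sequences by i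
  Q = (posScale Complex.I P.1, posScale Complex.I P.2)

/-- Two pairs are equivalent if one is obtained from the other by a finite
sequence of the operations E1–E5 (the equivalence relation generated by the
operations). -/
def GolayEquiv (n : ℕ) (P Q : (ℕ → ℂ) × (ℕ → ℂ)) : Prop :=
  Relation.EqvGen (GolayStep n) P Q

/-- The powers of `i` act transitively on the quaternary alphabet. -/
theorem exists_I_pow_mul_eq_one {z : ℂ} (hz : z ∈ ({1, -1, I, -I} : Set ℂ)) :
    ∃ m : ℕ, I ^ m * z = 1 := by
  rcases hz with rfl | rfl | rfl | rfl
  · exact ⟨0, by simp⟩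
  · exact ⟨2, by simp⟩
  · exact ⟨3, by simp [pow_succ]⟩
  · exact ⟨1, by simp⟩

theorem I_mul_mem_quaternary {z : ℂ} (hz : z ∈ ({1, -1, I, -I} : Set ℂ)) :
    I * z ∈ ({1, -1, I, -I} : Set ℂ) := by
  rcases hz with rfl | rfl | rfl | rfl <;> simp

theorem I_pow_mul_mem_quaternary {z : ℂ} (hz : z ∈ ({1, -1, I, -I} : Set ℂ)) (m : ℕ) :
    I ^ m * z ∈ ({1, -1, I, -I} : Set ℂ) := by
  induction m with
  | zero => simpa using hz
  | succ m ih =>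
    rw [pow_succ', mul_assoc]
    exact I_mul_mem_quaternary ih

theorem star_mem_quaternary {z : ℂ} (hz : z ∈ ({1, -1, I, -I} : Set ℂ)) :
    star z ∈ ({1, -1, I, -I} : Set ℂ) := by
  rcases hz with rfl | rfl | rfl | rfl <;> simp

theorem autocorr_reverse (n : ℕ) (A : ℕ → ℂ) (s : ℕ) :
    autocorr n (fun k => A (n - 1 - k)) s = star (autocorr n A s) := by
  unfold autocorr
  rw [star_sum, ← Finset.sum_range_reflect]
  refine Finset.sum_congr rfl fun k hk => ?_
  have hk' := Finset.mem_range.mp hk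
  beta_reduce
  rw [show n - 1 - (n - s - 1 - k) = k + s by omega,
    show n - 1 - (n - s - 1 - k + s) = k by omega, star_mul, star_star]

theorem autocorr_star (n : ℕ) (A : ℕ → ℂ) (s : ℕ) :
    autocorr n (fun k => star (A k)) s = star (autocorr n A s) := by
  unfold autocorr
  rw [star_sum]
  exact Finset.sum_congr rfl fun k _ => by rw [star_mul']

theorem autocorr_I_mul (n : ℕ) (A : ℕ → ℂ) (s : ℕ) :
    autocorr n (fun k => I * A k) s = autocorr n A s := by
  unfold autocorr
  refine Finset.sum_congr rfl fun k _ => ?_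
  have hI : I * star I = 1 := by simp
  rw [star_mul']
  linear_combination (A k * star (A (k + s))) * hI

theorem autocorr_posScale_I (n : ℕ) (A : ℕ → ℂ) (s : ℕ) :
    autocorr n (posScale I A) s = star I ^ s * autocorr n A s := by
  unfold autocorr posScale
  rw [Finset.mul_sum]
  refine Finset.sum_congr rfl fun k _ => ?_
  have hI : I ^ k * star I ^ k = 1 := by rw [← mul_pow]; simp
  rw [star_mul', star_pow, pow_add]
  linear_combination (A k * star (A (k + s)) * star I ^ s) * hI

theorem IsComplexGolayPair.of_step {n : ℕ} {P Q : (ℕ → ℂ) × (ℕ → ℂ)}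
    (hP : IsComplexGolayPair n P.1 P.2) (h : GolayStep n P Q) :
    IsComplexGolayPair n Q.1 Q.2 := by
  obtain ⟨hA, hB, hN⟩ := hP
  rcases h with rfl | rfl | rfl | rfl | rfl
  · refine ⟨fun k _ => hA _ (by omega), fun k _ => hB _ (by omega), fun s h1 h2 => ?_⟩
    rw [autocorr_reverse, autocorr_reverse, ← star_add, hN s h1 h2, star_zero]
  · refine ⟨fun k _ => star_mem_quaternary (hA _ (by omega)), hB, fun s h1 h2 => ?_⟩
    rw [autocorr_star n (fun k => P.1 (n - 1 - k)), autocorr_reverse, star_star]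
    exact hN s h1 h2
  · exact ⟨hB, hA, fun s h1 h2 => by rw [add_comm]; exact hN s h1 h2⟩
  · refine ⟨fun k hk => I_mul_mem_quaternary (hA k hk), hB, fun s h1 h2 => ?_⟩
    rw [autocorr_I_mul]
    exact hN s h1 h2
  · refine ⟨fun k hk => I_pow_mul_mem_quaternary (hA k hk) k,
      fun k hk => I_pow_mul_mem_quaternary (hB k hk) k, fun s h1 h2 => ?_⟩
    rw [autocorr_posScale_I, autocorr_posScale_I, ← mul_add, hN s h1 h2, mul_zero]

theorem IsComplexGolayPair.of_reflTransGen {n : ℕ} {P Q : (ℕ → ℂ) × (ℕ → ℂ)}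
    (hP : IsComplexGolayPair n P.1 P.2) (h : Relation.ReflTransGen (GolayStep n) P Q) :
    IsComplexGolayPair n Q.1 Q.2 := by
  induction h with
  | refl => exact hP
  | tail _ hs ih => exact ih.of_step hs

theorem reflTransGen_I_pow_mul_fst (n : ℕ) (A B : ℕ → ℂ) (m : ℕ) :
    Relation.ReflTransGen (GolayStep n) (A, B) (fun k => I ^ m * A k, B) := by
  induction m with
  | zero => simpa using Relation.ReflTransGen.refl
  | succ m ih =>
    refine ih.tail (Or.inr (Or.inr (Or.inr (Or.inl ?_))))
    simp only [pow_succ', mul_assoc]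

theorem reflTransGen_I_pow_mul_snd (n : ℕ) (A B : ℕ → ℂ) (m : ℕ) :
    Relation.ReflTransGen (GolayStep n) (A, B) (A, fun k => I ^ m * B k) := by
  have swap (X Y : ℕ → ℂ) : GolayStep n (X, Y) (Y, X) := Or.inr (Or.inr (Or.inl rfl))
  exact ((reflTransGen_I_pow_mul_fst n B A m).head (swap A B)).tail (swap _ A)

theorem reflTransGen_posScale_I_pow (n : ℕ) (A B : ℕ → ℂ) (m : ℕ) :
    Relation.ReflTransGen (GolayStep n) (A, B) (posScale (I ^ m) A, posScale (I ^ m) B) := by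
  induction m with
  | zero =>
    have one (X : ℕ → ℂ) : posScale 1 X = X := by funext k; simp [posScale]
    rw [pow_zero, one, one]
  | succ m ih =>
    refine ih.tail (Or.inr (Or.inr (Or.inr (Or.inr ?_))))
    have mul (X : ℕ → ℂ) : posScale (I ^ (m + 1)) X = posScale I (posScale (I ^ m) X) := by
      funext k
      simp only [posScale, pow_succ', mul_pow, mul_assoc]
    rw [mul, mul]

/-- Every complex Golay pair `(A', B')` of length `n ≥ 3` is
equivalent to a complex Golay pair `(A, B)` with `a₀ = a₁ = b₀ = 1` and
`a₂ ∈ {1, -1, i}`. -/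
theorem golay_normalize (n : ℕ) (hn : 3 ≤ n) (A' B' : ℕ → ℂ)
    (h : IsComplexGolayPair n A' B') :
    ∃ A B : ℕ → ℂ, IsComplexGolayPair n A B ∧ GolayEquiv n (A', B') (A, B) ∧
      A 0 = 1 ∧ A 1 = 1 ∧ B 0 = 1 ∧ A 2 ∈ ({1, -1, Complex.I} : Set ℂ) := by
  have hn0 : 0 < n := by omega
  obtain ⟨m₀, hm₀⟩ := exists_I_pow_mul_eq_one (h.1 0 hn0)
  have r₀ := reflTransGen_I_pow_mul_fst n A' B' m₀
  have h₀ := h.of_reflTransGen r₀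
  obtain ⟨m₁, hm₁⟩ := exists_I_pow_mul_eq_one (h₀.1 1 (by omega))
  have r₁ := r₀.trans (reflTransGen_posScale_I_pow n _ _ m₁)
  have h₁ := h.of_reflTransGen r₁
  obtain ⟨C, D, hr, hC0, hC1, hC2⟩ : ∃ C D : ℕ → ℂ,
      Relation.ReflTransGen (GolayStep n) (A', B') (C, D) ∧
        C 0 = 1 ∧ C 1 = 1 ∧ C 2 ∈ ({1, -1, I} : Set ℂ) := by
    generalize hA : posScale (I ^ m₁) (fun k => I ^ m₀ * A' k) = A at r₁ h₁
    generalize posScale (I ^ m₁) B' = B at r₁ h₁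
    have hA0 : A 0 = 1 := by simpa [← hA, posScale] using hm₀
    have hA1 : A 1 = 1 := by simpa [← hA, posScale] using hm₁
    rcases h₁.1 2 (by omega) with h2 | h2 | h2 | h2
    · exact ⟨A, B, r₁, hA0, hA1, by simp_all⟩
    · exact ⟨A, B, r₁, hA0, hA1, by simp_all⟩
    · exact ⟨A, B, r₁, hA0, hA1, by simp_all⟩
    · refine ⟨_, _, (r₁.tail (Or.inl rfl)).tail (Or.inr (Or.inl rfl)), ?_, ?_, ?_⟩
      · simp [hA0]
      · simp [show n - 1 - (n - 1 - 1) = 1 by omega, hA1]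
      · have h2' : A 2 = -I := h2
        simp [show n - 1 - (n - 1 - 2) = 2 by omega, h2']
  obtain ⟨m, hm⟩ := exists_I_pow_mul_eq_one ((h.of_reflTransGen hr).2.1 0 hn0)
  have hr' := hr.trans (reflTransGen_I_pow_mul_snd n C D m)
  exact ⟨C, _, h.of_reflTransGen hr', Relation.EqvGen.reflTransGen_le_eqvGen _ _ _ hr',
    hC0, hC1, hm, hC2⟩
end

section
/- Let (A, B) be a complex Golay pair of length n. Then a_k * a_{n-k-1} * b_k * b_{n-k-1} \in {1, -1} for every k = 0, ..., n-1. -/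
open Complex Finset

/-- The parity of the exponent `m` in `z = I ^ m`. -/
noncomputable def unitParity (z : ℂ) : ZMod 2 := if z.re = 0 then 1 else 0

theorem exists_int_im_mul_star {u v : ℂ} (hu : u ∈ ({1, -1, Complex.I, -Complex.I} : Set ℂ))
    (hv : v ∈ ({1, -1, Complex.I, -Complex.I} : Set ℂ)) :
    ∃ m : ℤ, (u * star v).im = m ∧ (m : ZMod 2) = unitParity u + unitParity v := by
  simp only [Set.mem_insert_iff, Set.mem_singleton_iff] at hu hv
  have h₂ : (1 : ZMod 2) + 1 = 0 := by decide
  have h₁ : (-1 : ZMod 2) = 1 := by decide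
  rcases hu with rfl | rfl | rfl | rfl <;> rcases hv with rfl | rfl | rfl | rfl <;>
    first
    | (refine ⟨0, ?_, ?_⟩ <;> simp [unitParity, h₂]; done)
    | (refine ⟨1, ?_, ?_⟩ <;> simp [unitParity]; done)
    | refine ⟨-1, ?_, ?_⟩ <;> simp [unitParity, h₁]

theorem IsQuaternarySeq.exists_int_im_autocorr {n : ℕ} {A : ℕ → ℂ} (hA : IsQuaternarySeq n A)
    (s : ℕ) : ∃ m : ℤ, (autocorr n A s).im = m ∧
      (m : ZMod 2) = ∑ k ∈ range (n - s), (unitParity (A k) + unitParity (A (k + s))) := by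
  have key : ∀ k, ∃ m : ℤ, k < n - s → (A k * star (A (k + s))).im = m ∧
      (m : ZMod 2) = unitParity (A k) + unitParity (A (k + s)) := by
    intro k
    by_cases hk : k < n - s
    · obtain ⟨m, hm⟩ := exists_int_im_mul_star (hA k (by omega)) (hA (k + s) (by omega))
      exact ⟨m, fun _ => hm⟩
    · exact ⟨0, fun h => absurd h hk⟩
  choose m hm using key
  refine ⟨∑ k ∈ range (n - s), m k, ?_, ?_⟩
  · rw [autocorr, Complex.im_sum, Int.cast_sum]
    exact sum_congr rfl fun k hk => (hm k (mem_range.1 hk)).1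
  · rw [Int.cast_sum]
    exact sum_congr rfl fun k hk => (hm k (mem_range.1 hk)).2

theorem IsComplexGolayPair.sum_unitParity_eq_zero {n : ℕ} {A B : ℕ → ℂ}
    (h : IsComplexGolayPair n A B) {m : ℕ} (hm : m < n) :
    ∑ k ∈ range m, (unitParity (A k) + unitParity (A (n - k - 1)) +
      (unitParity (B k) + unitParity (B (n - k - 1)))) = 0 := by
  obtain ⟨hA, hB, hAB⟩ := h
  rcases Nat.eq_zero_or_pos m with rfl | hpos
  · simp
  obtain ⟨p, hp, hp'⟩ := hA.exists_int_im_autocorr (n - m)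
  obtain ⟨q, hq, hq'⟩ := hB.exists_int_im_autocorr (n - m)
  have hpq : p + q = 0 := by
    have := congrArg Complex.im (hAB (n - m) (by omega) (by omega))
    rw [Complex.add_im, hp, hq, Complex.zero_im] at this
    exact_mod_cast this
  have hsum : (p : ZMod 2) + q = 0 := by exact_mod_cast congrArg (Int.cast : ℤ → ZMod 2) hpq
  have hreflect : ∀ f : ℕ → ZMod 2,
      ∑ k ∈ range m, f (k + (n - m)) = ∑ k ∈ range m, f (n - k - 1) := by
    intro f
    rw [← sum_range_reflect]
    refine sum_congr rfl fun k hk => congrArg f ?_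
    have := mem_range.1 hk
    omega
  rw [hp', hq', Nat.sub_sub_self hm.le] at hsum
  simp only [sum_add_distrib] at hsum ⊢
  rwa [hreflect fun k => unitParity (A k), hreflect fun k => unitParity (B k)] at hsum

theorem IsComplexGolayPair.unitParity_eq_zero {n : ℕ} {A B : ℕ → ℂ}
    (h : IsComplexGolayPair n A B) {k : ℕ} (hk : k < n) :
    unitParity (A k) + unitParity (A (n - k - 1)) +
      (unitParity (B k) + unitParity (B (n - k - 1))) = 0 := by
  have key : ∀ j, j + 1 < n → unitParity (A j) + unitParity (A (n - j - 1)) +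
      (unitParity (B j) + unitParity (B (n - j - 1))) = 0 := by
    intro j hj
    have := h.sum_unitParity_eq_zero hj
    rwa [sum_range_succ, h.sum_unitParity_eq_zero (by omega : j < n), zero_add] at this
  by_cases hk' : k + 1 < n
  · exact key k hk'
  obtain rfl : n = k + 1 := by omega
  rcases Nat.eq_zero_or_pos k with rfl | hpos
  · simp [CharTwo.add_self_eq_zero]
  · have := key 0 (by omega)
    simp only [Nat.sub_zero, Nat.add_sub_cancel, Nat.add_sub_cancel_left, Nat.sub_self] at this ⊢
    rw [← this]
    ring

theorem mul_mem_of_unitParity_eq_zero {a b c d : ℂ}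
    (ha : a ∈ ({1, -1, Complex.I, -Complex.I} : Set ℂ))
    (hb : b ∈ ({1, -1, Complex.I, -Complex.I} : Set ℂ))
    (hc : c ∈ ({1, -1, Complex.I, -Complex.I} : Set ℂ))
    (hd : d ∈ ({1, -1, Complex.I, -Complex.I} : Set ℂ))
    (h : unitParity a + unitParity b + (unitParity c + unitParity d) = 0) :
    a * b * c * d ∈ ({1, -1} : Set ℂ) := by
  have h₂ : (1 : ZMod 2) + 1 = 0 := by decide
  simp only [Set.mem_insert_iff, Set.mem_singleton_iff] at ha hb hc hd
  rcases ha with rfl | rfl | rfl | rfl <;> rcases hb with rfl | rfl | rfl | rfl <;>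
    rcases hc with rfl | rfl | rfl | rfl <;> rcases hd with rfl | rfl | rfl | rfl <;>
    simp [unitParity, h₂] at h ⊢

/-- If `(A, B)` is a complex Golay pair of length `n`, then
`aₖ · a_{n-k-1} · bₖ · b_{n-k-1} = ±1` for every `k = 0, …, n-1`. -/
theorem golay_product_real (n : ℕ) (A B : ℕ → ℂ) (h : IsComplexGolayPair n A B) :
    ∀ k < n, A k * A (n - k - 1) * B k * B (n - k - 1) ∈ ({1, -1} : Set ℂ) := by
  intro k hk
  have hk' : n - k - 1 < n := by omega
  exact mul_mem_of_unitParity_eq_zero (h.1 k hk) (h.1 _ hk') (h.2.1 k hk) (h.2.1 _ hk')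
    (h.unitParity_eq_zero hk)
end
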